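/- Let k be a field, n a natural number, S = k[z_1,…,z_n], and let I, J ⊆ Fin n. For every natural number t, the torsion group Tor_t^S(S/A_I, S/A_J) is isomorphic, as an S-module, to a direct sum of copies of S/A_{I∪J} indexed by the subsets T ⊆ I ∩ J with |T| = t; that is, Tor_t^S(S/A_I, S/A_J) ≅ (S/A_{I∪J})^{⊕ binom(|I∩J|, t)}. -/

import Mathlib

open CategoryTheory MvPolynomial

noncomputable section

/-- `A_I`, the ideal of `k[z_1,…,z_n]` generated by the variables `z_i`, `i ∈ I`. -/
def varIdeal (k : Type) [Field k] (n : ℕ) (I : Finset (Fin n)) :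
    Ideal (MvPolynomial (Fin n) k) :=
  Ideal.span ((fun i => (X i : MvPolynomial (Fin n) k)) '' ↑I)

/-- The cyclic module `S/A_I` as an object of `ModuleCat S`. -/
def cyclicMod (k : Type) [Field k] (n : ℕ) (I : Finset (Fin n)) :
    ModuleCat (MvPolynomial (Fin n) k) :=
  ModuleCat.of (MvPolynomial (Fin n) k) (MvPolynomial (Fin n) k ⧸ varIdeal k n I)


section TorAux

open CategoryTheory.MonoidalCategory

universe u
variable {R : Type u} [CommRing R]

/-- the complex `M ⊗ P`, functorial in `M`. -/
def tC (P : ChainComplex (ModuleCat.{u} R) ℕ) (M : ModuleCat.{u} R) :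
    ChainComplex (ModuleCat.{u} R) ℕ :=
  (((tensoringLeft (ModuleCat.{u} R)).obj M).mapHomologicalComplex _).obj P

/-- functoriality of `tC`. -/
def tCmap (P : ChainComplex (ModuleCat.{u} R) ℕ) {M N : ModuleCat.{u} R} (f : M ⟶ N) :
    tC P M ⟶ tC P N :=
  (NatTrans.mapHomologicalComplex ((tensoringLeft (ModuleCat.{u} R)).map f) _).app P

lemma tCmap_f (P : ChainComplex (ModuleCat.{u} R) ℕ) {M N : ModuleCat.{u} R} (f : M ⟶ N) (i : ℕ) :
    (tCmap P f).f i = f ▷ P.X i := rfl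

lemma homologyMap_smul_id (K : ChainComplex (ModuleCat.{u} R) ℕ) (x : R) (t : ℕ) :
    HomologicalComplex.homologyMap (x • 𝟙 K) t = x • 𝟙 (K.homology t) := by
  have := ShortComplex.homologyMap_smul
    (φ := (HomologicalComplex.shortComplexFunctor (ModuleCat.{u} R) _ t).map (𝟙 K)) x
  rw [CategoryTheory.Functor.map_id, ShortComplex.homologyMap_id] at this
  exact this

lemma tCmap_smul (P : ChainComplex (ModuleCat.{u} R) ℕ) (M : ModuleCat.{u} R) (x : R) :
    tCmap P (x • 𝟙 M) = x • 𝟙 (tC P M) := by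
  ext i : 1
  rw [tCmap_f]
  simp [MonoidalLinear.smul_whiskerRight]
  rfl

lemma tCmap_smul' (P : ChainComplex (ModuleCat.{u} R) ℕ) (M : ModuleCat.{u} R) (x : R) :
    (((tensoringLeft (ModuleCat.{u} R)).obj M).mapHomologicalComplex _).map (x • 𝟙 P)
      = x • 𝟙 (tC P M) := by
  ext i : 1
  simp
  rfl

/-- elements killing `M` kill the homology of `M ⊗ P`. -/
lemma smul_homology_left (P : ChainComplex (ModuleCat.{u} R) ℕ) (M : ModuleCat.{u} R) (x : R)
    (hx : ∀ m : M, x • m = 0) (t : ℕ) (h : (tC P M).homology t) : x • h = 0 := by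
  have h0 : x • 𝟙 M = 0 := by ext m; exact hx m
  have h1 : x • 𝟙 (tC P M) = 0 := by
    rw [← tCmap_smul, h0]; ext i : 1; rw [tCmap_f]; simp; rfl
  have h2 := homologyMap_smul_id (tC P M) x t
  rw [h1, HomologicalComplex.homologyMap_zero] at h2
  have := congrArg (fun f => f.hom h) h2
  exact this.symm

lemma smul_homology_right {N : ModuleCat.{u} R} (P : ProjectiveResolution N)
    (M : ModuleCat.{u} R) (x : R)
    (hx : ∀ m : N, x • m = 0) (t : ℕ) (h : (tC P.complex M).homology t) : x • h = 0 := by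
  have h0 : x • 𝟙 N = 0 := by ext m; exact hx m
  have ho : Homotopy (x • 𝟙 P.complex) 0 := by
    refine ProjectiveResolution.liftHomotopyZero (P := P) (Q := P) _ ?_
    have h3 : (x • 𝟙 P.complex) ≫ P.π = P.π ≫ (ChainComplex.single₀ _).map (x • 𝟙 N) := by
      apply HomologicalComplex.hom_ext
      intro i
      cases i with
      | zero =>
        simp
        exact ((Linear.comp_smul (R := R) (C := ModuleCat.{u} R) _ _ _ (P.π.f 0) x (𝟙 N)).trans
          (congrArg (fun f => x • f) (Category.comp_id _))).symm
      | succ n => simp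
    rw [h3, h0, Functor.map_zero, Limits.comp_zero]
  have h1 := (Functor.mapHomotopy ((tensoringLeft (ModuleCat.{u} R)).obj M) ho).homologyMap_eq t
  rw [tCmap_smul', Functor.map_zero, HomologicalComplex.homologyMap_zero] at h1
  have h2 := homologyMap_smul_id (tC P.complex M) x t
  have := congrArg (fun f => f.hom h) (h2.symm.trans h1)
  exact this

lemma les (P : ChainComplex (ModuleCat.{u} R) ℕ) [∀ i, Projective (P.X i)]
    {M M' : ModuleCat.{u} R} (x : R) (hx : ∀ m : M, x • m = 0 → m = 0) (g : M ⟶ M')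
    (hg : Function.Surjective g) (hex : ∀ m : M, g m = 0 ↔ ∃ m', x • m' = m) :
    ∃ (a : ∀ t, (tC P M).homology t →ₗ[R] (tC P M').homology t)
      (δ : ∀ t, (tC P M').homology (t+1) →ₗ[R] (tC P M).homology t),
      Function.Surjective (a 0) ∧
      (∀ t h, a t h = 0 ↔ ∃ h', x • h' = h) ∧
      (∀ t, Function.Exact (a (t+1)) (δ t)) ∧
      (∀ t h, x • h = 0 ↔ ∃ h', δ t h' = h) := by
  have w : (x • 𝟙 M) ≫ g = 0 := by
    ext m
    exact (hex _).2 ⟨m, rfl⟩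
  let S : ShortComplex (ModuleCat.{u} R) := ShortComplex.mk (x • 𝟙 M) g w
  have hS : S.ShortExact := by
    refine ModuleCat.shortComplex_shortExact _ ?_ ?_ hg
    · intro m
      exact hex m
    · exact (injective_iff_map_eq_zero (x • 𝟙 M : M ⟶ M).hom).2 (fun m h => hx m h)
  have w' : tCmap P (x • 𝟙 M) ≫ tCmap P g = 0 := by
    ext i : 1
    rw [HomologicalComplex.comp_f, tCmap_f, tCmap_f]
    refine (comp_whiskerRight _ _ _).symm.trans ?_
    rw [w]
    simp
    rfl
  let T : ShortComplex (ChainComplex (ModuleCat.{u} R) ℕ) :=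
    ShortComplex.mk (tCmap P (x • 𝟙 M)) (tCmap P g) w'
  have hT : T.ShortExact := by
    apply HomologicalComplex.shortExact_of_degreewise_shortExact
    intro i
    have : Module.Projective R (P.X i) := (IsProjective.iff_projective _).2 inferInstance
    have : Module.Flat R (P.X i) := inferInstance
    exact hS.map_of_exact (tensorRight (P.X i))
  have hmul : ∀ t, HomologicalComplex.homologyMap T.f t = x • 𝟙 ((tC P M).homology t) := by
    intro t
    rw [← homologyMap_smul_id, ← tCmap_smul]
  have rel : ∀ t, (ComplexShape.down ℕ).Rel (t+1) t := fun t => rfl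
  have hepi : Epi (HomologicalComplex.homologyMap T.g 0) := by
    have := hT.epi_g
    exact HomologicalComplex.epi_homologyMap_of_epi_of_not_rel _ _ (by simp)
  refine ⟨fun t => (HomologicalComplex.homologyMap T.g t).hom,
    fun t => (hT.δ (t+1) t (rel t)).hom, ?_, ?_, ?_, ?_⟩
  · exact (ModuleCat.epi_iff_surjective _).1 hepi
  · intro t h
    have := (ShortComplex.ShortExact.moduleCat_exact_iff_function_exact _).1 (hT.homology_exact₂ t) h
    have hm := hmul t
    dsimp only at this
    generalize_proofs at this
    simp only [hm] at this
    exact this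
  · intro t
    exact (ShortComplex.ShortExact.moduleCat_exact_iff_function_exact _).1
      (hT.homology_exact₃ (t+1) t (rel t))
  · intro t h
    have := (ShortComplex.ShortExact.moduleCat_exact_iff_function_exact _).1
      (hT.homology_exact₁ (t+1) t (rel t)) h
    have hm := hmul t
    dsimp only at this
    generalize_proofs at this
    simp only [hm] at this
    exact this

end TorAux

section AlgAux

variable {R : Type*} [CommRing R]

lemma exists_section_aux {ι : Type*} [Fintype ι] (a : Ideal R) {B : Type*} [AddCommGroup B]
    [Module R B] (hB : ∀ x ∈ a, ∀ b : B, x • b = 0) (g : B →ₗ[R] (ι → R ⧸ a))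
    (hg : Function.Surjective g) : ∃ l : (ι → R ⧸ a) →ₗ[R] B, g ∘ₗ l = LinearMap.id := by
  classical
  choose b hb using fun i : ι => hg (Pi.single i 1)
  refine ⟨∑ i, (Submodule.liftQ a (LinearMap.toSpanSingleton R B (b i))
    (fun x hx => by simpa using hB x hx (b i))) ∘ₗ LinearMap.proj i, ?_⟩
  refine LinearMap.pi_ext' fun i => ?_
  refine Submodule.linearMap_qext _ ?_
  refine LinearMap.ext_ring ?_
  simp only [LinearMap.comp_apply, LinearMap.sum_apply, LinearMap.id_apply, LinearMap.proj_apply,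
    LinearMap.single_apply]
  rw [Finset.sum_eq_single i]
  · rw [Pi.single_eq_same, Submodule.mkQ_apply, Submodule.liftQ_apply,
      LinearMap.toSpanSingleton_apply, one_smul, hb]
    rfl
  · intro j _ hj
    rw [Pi.single_eq_of_ne hj, map_zero]
  · simp

lemma split_aux (a : Ideal R) {A B C : Type*} [AddCommGroup A] [Module R A] [AddCommGroup B]
    [Module R B] [AddCommGroup C] [Module R C] (hB : ∀ x ∈ a, ∀ b : B, x • b = 0)
    (f : A →ₗ[R] B) (g : B →ₗ[R] C) (hf : Function.Injective f) (hg : Function.Surjective g)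
    (h : Function.Exact f g) (p q r : ℕ) (hr : r = p + q) (eA : A ≃ₗ[R] (Fin p → R ⧸ a))
    (eC : C ≃ₗ[R] (Fin q → R ⧸ a)) : Nonempty (B ≃ₗ[R] (Fin r → R ⧸ a)) := by
  subst hr
  obtain ⟨l, hl⟩ := exists_section_aux a hB (eC.toLinearMap ∘ₗ g) (eC.surjective.comp hg)
  have hl' : g ∘ₗ (l ∘ₗ eC.toLinearMap) = LinearMap.id := by
    ext c
    have := congrArg (fun φ => eC.symm (φ (eC c))) hl
    simpa using this
  exact ⟨(h.splitSurjectiveEquiv hf ⟨_, hl'⟩).1 ≪≫ₗ (eA.prodCongr eC) ≪≫ₗ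
    (LinearEquiv.sumArrowLequivProdArrow (Fin p) (Fin q) R (R ⧸ a)).symm ≪≫ₗ
    LinearEquiv.funCongrLeft R (R ⧸ a) finSumFinEquiv.symm⟩

lemma mapQ_ker_aux (a b : Ideal R) (x : R) (hab : b = a ⊔ Ideal.span {x}) (hle : a ≤ b) :
    ∀ y, Submodule.mapQ a b LinearMap.id hle y = 0 ↔ ∃ y', x • y' = y := by
  intro y
  obtain ⟨r, rfl⟩ := Submodule.Quotient.mk_surjective _ y
  rw [Submodule.mapQ_apply, Submodule.Quotient.mk_eq_zero, LinearMap.id_apply, hab,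
    Submodule.mem_sup]
  constructor
  · rintro ⟨u, hu, v, hv, rfl⟩
    obtain ⟨w, rfl⟩ := Ideal.mem_span_singleton'.1 hv
    refine ⟨Submodule.Quotient.mk w, ?_⟩
    rw [← Submodule.Quotient.mk_smul, eq_comm, Submodule.Quotient.eq]
    simpa [mul_comm] using hu
  · rintro ⟨y', hy'⟩
    obtain ⟨w, rfl⟩ := Submodule.Quotient.mk_surjective _ y'
    rw [← Submodule.Quotient.mk_smul, eq_comm, Submodule.Quotient.eq] at hy'
    exact ⟨_, hy', x * w, Ideal.mem_span_singleton'.2 ⟨w, mul_comm _ _⟩, by simp⟩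

lemma quot_aux (a b : Ideal R) (x : R) (hab : b = a ⊔ Ideal.span {x}) {A B : Type*}
    [AddCommGroup A] [Module R A] [AddCommGroup B] [Module R B]
    (g : A →ₗ[R] B) (hg : Function.Surjective g)
    (h : ∀ y, g y = 0 ↔ ∃ y', x • y' = y) (p : ℕ) (eA : A ≃ₗ[R] (Fin p → R ⧸ a)) :
    Nonempty (B ≃ₗ[R] (Fin p → R ⧸ b)) := by
  have hle : a ≤ b := hab ▸ le_sup_left
  let q : (Fin p → R ⧸ a) →ₗ[R] (Fin p → R ⧸ b) :=
    LinearMap.pi fun i => (Submodule.mapQ a b LinearMap.id hle) ∘ₗ LinearMap.proj i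
  have hq0 : Function.Surjective (Submodule.mapQ a b LinearMap.id hle) := by
    intro y
    obtain ⟨r, rfl⟩ := Submodule.Quotient.mk_surjective _ y
    exact ⟨Submodule.Quotient.mk r, rfl⟩
  have hk0 := mapQ_ker_aux a b x hab hle
  have hq : Function.Surjective q := by
    intro y
    choose z hz using fun i => hq0 (y i)
    exact ⟨z, funext hz⟩
  have hk : ∀ y, q y = 0 ↔ ∃ y', x • y' = y := by
    intro y
    constructor
    · intro hy
      choose z hz using fun i => (hk0 (y i)).1 (congrFun hy i)
      exact ⟨z, funext hz⟩
    · rintro ⟨y', rfl⟩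
      ext i : 1
      exact (hk0 _).2 ⟨y' i, rfl⟩
  have hker : LinearMap.ker g = LinearMap.ker (q ∘ₗ eA.toLinearMap) := by
    ext y
    rw [LinearMap.mem_ker, LinearMap.mem_ker, h, LinearMap.comp_apply, hk]
    constructor
    · rintro ⟨y', rfl⟩; exact ⟨eA y', by simp⟩
    · rintro ⟨y', hy'⟩; exact ⟨eA.symm y', eA.injective (by simpa using hy')⟩
  exact ⟨(g.quotKerEquivOfSurjective hg).symm ≪≫ₗ Submodule.quotEquivOfEq _ _ hker ≪≫ₗ
    (q ∘ₗ eA.toLinearMap).quotKerEquivOfSurjective (hq.comp eA.surjective)⟩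

end AlgAux

section VarIdeal

variable (k : Type) [Field k] (n : ℕ)

lemma varIdeal_union (I J : Finset (Fin n)) :
    varIdeal k n (I ∪ J) = varIdeal k n I ⊔ varIdeal k n J := by
  simp [varIdeal, Set.image_union]

lemma varIdeal_singleton (i : Fin n) : varIdeal k n {i} = Ideal.span {X i} := by
  simp [varIdeal]

lemma varIdeal_insert (i : Fin n) (I : Finset (Fin n)) :
    varIdeal k n (insert i I) = varIdeal k n I ⊔ Ideal.span {X i} := by
  rw [Finset.insert_eq, varIdeal_union, varIdeal_singleton, sup_comm]

lemma X_mul_mem_varIdeal (i : Fin n) (I : Finset (Fin n)) (hi : i ∉ I)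
    (p : MvPolynomial (Fin n) k) (h : X i * p ∈ varIdeal k n I) : p ∈ varIdeal k n I := by
  rw [varIdeal, mem_ideal_span_X_image] at h ⊢
  intro m hm
  obtain ⟨j, hj, hne⟩ := h (Finsupp.single i 1 + m) (by
    rw [mem_support_iff, coeff_X_mul]; exact mem_support_iff.1 hm)
  refine ⟨j, hj, ?_⟩
  have : i ≠ j := fun e => hi (e ▸ hj)
  simpa [Finsupp.single_apply, this] using hne

lemma X_smul_quot (i : Fin n) (I : Finset (Fin n)) (hi : i ∉ I)
    (y : MvPolynomial (Fin n) k ⧸ varIdeal k n I)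
    (h : (X i : MvPolynomial (Fin n) k) • y = 0) : y = 0 := by
  obtain ⟨r, rfl⟩ := Submodule.Quotient.mk_surjective _ y
  rw [← Submodule.Quotient.mk_smul, Submodule.Quotient.mk_eq_zero] at h
  rw [Submodule.Quotient.mk_eq_zero]
  exact X_mul_mem_varIdeal k n i I hi r h

lemma smul_quot_eq_zero {R : Type*} [CommRing R] (a : Ideal R) (x : R) (hx : x ∈ a) (y : R ⧸ a) :
    x • y = 0 := by
  obtain ⟨r, rfl⟩ := Submodule.Quotient.mk_surjective _ y
  rw [← Submodule.Quotient.mk_smul, Submodule.Quotient.mk_eq_zero]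
  exact Ideal.mul_mem_right _ _ hx

end VarIdeal

section Main

open CategoryTheory.MonoidalCategory

variable (k : Type) [Field k] (n : ℕ)

lemma torBase (J : Finset (Fin n)) (P : ProjectiveResolution (cyclicMod k n J)) (t : ℕ) :
    Nonempty ((tC P.complex (cyclicMod k n ∅)).homology t ≃ₗ[MvPolynomial (Fin n) k]
      (Fin (((∅ : Finset (Fin n)) ∩ J).card.choose t) →
        MvPolynomial (Fin n) k ⧸ varIdeal k n (∅ ∪ J))) := by
  have e0 : (cyclicMod k n ∅) ≃ₗ[MvPolynomial (Fin n) k] MvPolynomial (Fin n) k :=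
    Submodule.quotEquivOfEqBot _ (by simp [varIdeal])
  let e1 : cyclicMod k n ∅ ≅ 𝟙_ (ModuleCat (MvPolynomial (Fin n) k)) :=
    LinearEquiv.toModuleIso e0
  let e2 : (tensoringLeft (ModuleCat (MvPolynomial (Fin n) k))).obj (cyclicMod k n ∅) ≅
      𝟭 _ := (tensoringLeft _).mapIso e1 ≪≫ leftUnitorNatIso _
  let e3 : tC P.complex (cyclicMod k n ∅) ≅ P.complex :=
    (NatIso.mapHomologicalComplex e2 (ComplexShape.down ℕ)).app P.complex ≪≫
      (Functor.mapHomologicalComplexIdIso _ _).app P.complex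
  let e4 : (tC P.complex (cyclicMod k n ∅)).homology t ≅ P.complex.homology t :=
    (HomologicalComplex.homologyFunctor _ _ t).mapIso e3
  cases t with
  | zero =>
    let e5 := isoOfQuasiIsoAt P.π 0 ≪≫ HomologicalComplex.singleObjHomologySelfIso _ 0 _
    let e6 : (tC P.complex (cyclicMod k n ∅)).homology 0 ≃ₗ[MvPolynomial (Fin n) k]
      (MvPolynomial (Fin n) k ⧸ varIdeal k n J) := (e4 ≪≫ e5).toLinearEquiv
    rw [Nat.choose_zero_right, Finset.empty_union]
    exact ⟨e6 ≪≫ₗ (LinearEquiv.funUnique (Fin 1) _ _).symm⟩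
  | succ t =>
    have hz := (P.complex_exactAt_succ t).isZero_homology.of_iso e4
    have := ModuleCat.subsingleton_of_isZero hz
    rw [Finset.empty_inter, Finset.card_empty, Nat.choose_zero_succ]
    exact ⟨LinearEquiv.ofSubsingleton _ _⟩

lemma torAux (J : Finset (Fin n)) (P : ProjectiveResolution (cyclicMod k n J))
    (I : Finset (Fin n)) : ∀ t : ℕ,
    Nonempty ((tC P.complex (cyclicMod k n I)).homology t ≃ₗ[MvPolynomial (Fin n) k]
      (Fin ((I ∩ J).card.choose t) → MvPolynomial (Fin n) k ⧸ varIdeal k n (I ∪ J))) := by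
  induction I using Finset.induction_on with
  | empty => exact torBase k n J P
  | insert i I hi ih =>
    have hle : varIdeal k n I ≤ varIdeal k n (insert i I) :=
      varIdeal_insert k n i I ▸ le_sup_left
    let g : cyclicMod k n I ⟶ cyclicMod k n (insert i I) :=
      ModuleCat.ofHom (Submodule.mapQ (varIdeal k n I) (varIdeal k n (insert i I))
        LinearMap.id hle)
    have hg : Function.Surjective g := by
      intro y
      obtain ⟨r, rfl⟩ := Submodule.Quotient.mk_surjective _ y
      exact ⟨Submodule.Quotient.mk r, rfl⟩
    have hex : ∀ m : cyclicMod k n I, g m = 0 ↔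
        ∃ m', (X i : MvPolynomial (Fin n) k) • m' = m := by
      exact mapQ_ker_aux _ _ (X i) (varIdeal_insert k n i I) hle
    obtain ⟨a, δ, ha0, hax, hex2, hδ⟩ := les P.complex (X i : MvPolynomial (Fin n) k)
      (M := cyclicMod k n I) (fun m hm => X_smul_quot k n i I hi m hm) g hg hex
    by_cases hiJ : i ∈ J
    · have hU : insert i I ∪ J = I ∪ J := by grind
      have hC : (insert i I ∩ J).card = (I ∩ J).card + 1 := by
        rw [Finset.insert_inter_of_mem hiJ, Finset.card_insert_of_notMem (by simp [hi])]
      have hkill : ∀ t (h : (tC P.complex (cyclicMod k n I)).homology t),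
          (X i : MvPolynomial (Fin n) k) • h = 0 := fun t h =>
        smul_homology_right P _ _ (fun m => smul_quot_eq_zero (varIdeal k n J) _
          (Ideal.subset_span ⟨i, hiJ, rfl⟩) m) t h
      have hinj : ∀ t, Function.Injective (a t) := fun t =>
        (injective_iff_map_eq_zero _).2 fun h hh => by
          obtain ⟨h', rfl⟩ := (hax t h).1 hh
          exact hkill t h'
      rw [hC, hU]
      intro t
      cases t with
      | zero =>
        obtain ⟨e⟩ := ih 0
        rw [Nat.choose_zero_right] at e ⊢
        exact ⟨(LinearEquiv.ofBijective (a 0) ⟨hinj 0, ha0⟩).symm ≪≫ₗ e⟩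
      | succ t =>
        obtain ⟨e⟩ := ih (t + 1)
        obtain ⟨e'⟩ := ih t
        refine split_aux (varIdeal k n (I ∪ J)) ?_ (a (t + 1)) (δ t) (hinj _)
          (fun h => (hδ t h).1 (hkill t h)) (hex2 t) _ _ _ ?_ e e'
        · intro x hx b
          rw [← hU, varIdeal_union, Submodule.mem_sup] at hx
          obtain ⟨y, hy, z, hz, rfl⟩ := hx
          rw [add_smul, smul_homology_left _ _ y (fun m => smul_quot_eq_zero _ _ hy m),
            smul_homology_right P _ z (fun m => smul_quot_eq_zero _ _ hz m), add_zero]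
        · rw [Nat.choose_succ_succ, add_comm]
    · have hC : insert i I ∩ J = I ∩ J := Finset.insert_inter_of_notMem hiJ
      have hU : insert i I ∪ J = insert i (I ∪ J) := Finset.insert_union _ _ _
      have hreg : ∀ t (h : (tC P.complex (cyclicMod k n I)).homology t),
          (X i : MvPolynomial (Fin n) k) • h = 0 → h = 0 := by
        intro t h hh
        obtain ⟨e⟩ := ih t
        apply e.injective
        rw [map_zero]
        ext j : 1
        apply X_smul_quot k n i (I ∪ J) (by simp [hi, hiJ])
        have := congrArg e hh
        rw [map_smul, map_zero] at this
        exact congrFun this j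
      intro t
      obtain ⟨e⟩ := ih t
      rw [hC, hU]
      refine quot_aux _ _ (X i) (varIdeal_insert k n i (I ∪ J)) (a t) ?_ (hax t) _ e
      cases t with
      | zero => exact ha0
      | succ t =>
        intro y
        exact (hex2 t y).1 (hreg t _ ((hδ t _).2 ⟨y, rfl⟩))

end Main

/-- `Tor_t^S(S/A_I, S/A_J)` is isomorphic, as an `S`-module, to the
direct sum of copies of `S/A_{I∪J}` indexed by the subsets `T ⊆ I ∩ J` with
`|T| = t`; the number of such subsets is `binom(|I∩J|, t)`. -/
theorem stmt1 (k : Type) [Field k] (n : ℕ) (I J : Finset (Fin n)) (t : ℕ) :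
    Nonempty
      ((((Tor (ModuleCat (MvPolynomial (Fin n) k)) t).obj (cyclicMod k n I)).obj
          (cyclicMod k n J)) ≃ₗ[MvPolynomial (Fin n) k]
        ({T : Finset (Fin n) // T ⊆ I ∩ J ∧ T.card = t} →
          MvPolynomial (Fin n) k ⧸ varIdeal k n (I ∪ J))) ∧
    Fintype.card {T : Finset (Fin n) // T ⊆ I ∩ J ∧ T.card = t} =
      ((I ∩ J).card).choose t := by
  have hcard : Fintype.card {T : Finset (Fin n) // T ⊆ I ∩ J ∧ T.card = t} =
      ((I ∩ J).card).choose t := by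
    rw [← Finset.card_powersetCard]
    exact Fintype.card_of_subtype _ (fun T => Finset.mem_powersetCard)
  refine ⟨?_, hcard⟩
  let P := ProjectiveResolution.of (cyclicMod k n J)
  obtain ⟨e⟩ := torAux k n J P I t
  let e1 : (((Tor (ModuleCat (MvPolynomial (Fin n) k)) t).obj (cyclicMod k n I)).obj
          (cyclicMod k n J)) ≅ (tC P.complex (cyclicMod k n I)).homology t :=
    P.isoLeftDerivedObj _ t
  exact ⟨e1.toLinearEquiv ≪≫ₗ e ≪≫ₗ
    LinearEquiv.funCongrLeft _ _ (Fintype.equivFinOfCardEq hcard)⟩
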